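/- For each k ≥ 1, let g_n^{(k)} denote the number of λυ-terms of size n that ψ-normalise in exactly k normal-order ψ-reduction steps, and let t_n denote the total number of λυ-terms of size n. Then the asymptotic density μ_k = lim_{n→∞} g_n^{(k)}/t_n exists and is strictly positive. -/

import Mathlib

mutual
/-- λυ-terms in de Bruijn notation, with explicit closures. -/
inductive LTerm : Type
  | idx : Nat → LTerm
  | lam : LTerm → LTerm
  | app : LTerm → LTerm → LTerm
  | clos : LTerm → LSub → LTerm
  deriving DecidableEq

/-- explicit λυ-substitutions. -/
inductive LSub : Type
  | slash : LTerm → LSub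
  | lift : LSub → LSub
  | shift : LSub
  deriving DecidableEq
end

mutual
/-- natural size of a λυ-term: the number of constructors (|idx n| = n+1). -/
def LTerm.size : LTerm → Nat
  | .idx n => n + 1
  | .lam a => 1 + a.size
  | .app a b => 1 + a.size + b.size
  | .clos a s => 1 + a.size + s.size

/-- natural size of a substitution. -/
def LSub.size : LSub → Nat
  | .slash a => 1 + a.size
  | .lift s => 1 + s.size
  | .shift => 1
end

/-- a λυ-term is pure if it contains no closure; pure terms are exactly the ψ-normal forms. -/
def LTerm.IsPure : LTerm → Prop
  | .idx _ => True
  | .lam a => a.IsPure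
  | .app a b => a.IsPure ∧ b.IsPure
  | .clos _ _ => False

/-- one normal-order (leftmost-outermost) ψ-reduction step. -/
inductive NStep : LTerm → LTerm → Prop
  /-- (App) (ab)[s] → a[s](b[s]) -/
  | appS (a b : LTerm) (s : LSub) :
      NStep (.clos (.app a b) s) (.app (.clos a s) (.clos b s))
  /-- (Lambda) (λa)[s] → λ(a[⇑(s)]) -/
  | lamS (a : LTerm) (s : LSub) :
      NStep (.clos (.lam a) s) (.lam (.clos a (.lift s)))
  /-- (FVar) 0[a/] → a -/
  | fvar (a : LTerm) : NStep (.clos (.idx 0) (.slash a)) a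
  /-- (RVar) (S n)[a/] → n -/
  | rvar (n : Nat) (a : LTerm) : NStep (.clos (.idx (n+1)) (.slash a)) (.idx n)
  /-- (FVarLift) 0[⇑(s)] → 0 -/
  | fvarLift (s : LSub) : NStep (.clos (.idx 0) (.lift s)) (.idx 0)
  /-- (RVarLift) (S n)[⇑(s)] → n[s][↑] -/
  | rvarLift (n : Nat) (s : LSub) :
      NStep (.clos (.idx (n+1)) (.lift s)) (.clos (.clos (.idx n) s) .shift)
  /-- (VarShift) n[↑] → S n -/
  | varShift (n : Nat) : NStep (.clos (.idx n) .shift) (.idx (n+1))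
  /-- reduce under an abstraction -/
  | lamCong {a a' : LTerm} : NStep a a' → NStep (.lam a) (.lam a')
  /-- reduce in the left part of an application -/
  | appLeft {a a' : LTerm} (b : LTerm) : NStep a a' → NStep (.app a b) (.app a' b)
  /-- reduce in the right part of an application, provided the left part is normal -/
  | appRight {b b' : LTerm} (a : LTerm) :
      a.IsPure → NStep b b' → NStep (.app a b) (.app a b')
  /-- reduce in the body of a closure, provided the closure is not itself a ψ-redex,
      i.e. its body is again a closure -/
  | closCong {t t' : LTerm} (s : LSub) :
      (∃ u v, t = LTerm.clos u v) → NStep t t' → NStep (.clos t s) (.clos t' s)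

/-- `NormIn t k` : `t` reaches its ψ-normal form in exactly `k` normal-order
ψ-reduction steps (written t ↓_k). -/
inductive NormIn : LTerm → Nat → Prop
  | base {t : LTerm} : t.IsPure → NormIn t 0
  | step {t t' : LTerm} {k : Nat} : NStep t t' → NormIn t' k → NormIn t (k+1)

/-- the number g_n^{(k)} of λυ-terms of size n that ψ-normalise in exactly k
normal-order ψ-reduction steps. -/
noncomputable def normCount (k n : ℕ) : ℕ :=
  Nat.card {t : LTerm // t.size = n ∧ NormIn t k}

/-- the total number t_n of λυ-terms of size n. -/
noncomputable def termCount (n : ℕ) : ℕ :=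
  Nat.card {t : LTerm // t.size = n}

mutual
/-- Patterns of λυ-terms: a hole stands for an arbitrary term. -/
inductive PatTerm : Type
  | hole : PatTerm
  | idx : ℕ → PatTerm
  | lam : PatTerm → PatTerm
  | app : PatTerm → PatTerm → PatTerm
  | clos : PatTerm → PatSub → PatTerm

/-- Patterns of λυ-substitutions: a hole stands for an arbitrary substitution. -/
inductive PatSub : Type
  | hole : PatSub
  | slash : PatTerm → PatSub
  | lift : PatSub → PatSub
  | shift : PatSub
end

mutual
/-- `p.Le t`: the term `t` is an instance of the pattern `p`. -/
def PatTerm.Le : PatTerm → LTerm → Prop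
  | .hole, _ => True
  | .idx n, .idx m => n = m
  | .lam a, .lam b => a.Le b
  | .app a b, .app c d => a.Le c ∧ b.Le d
  | .clos a s, .clos c r => a.Le c ∧ s.Le r
  | _, _ => False

/-- `p.Le s`: the substitution `s` is an instance of the pattern `p`. -/
def PatSub.Le : PatSub → LSub → Prop
  | .hole, _ => True
  | .slash a, .slash b => a.Le b
  | .lift s, .lift r => s.Le r
  | .shift, .shift => True
  | _, _ => False
end

mutual
/-- The number of constructors of a pattern, not counting holes. -/
def PatTerm.size : PatTerm → ℕ
  | .hole => 0
  | .idx n => n + 1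
  | .lam a => a.size + 1
  | .app a b => a.size + b.size + 1
  | .clos a s => a.size + s.size + 1

/-- The number of constructors of a pattern, not counting holes. -/
def PatSub.size : PatSub → ℕ
  | .hole => 0
  | .slash a => a.size + 1
  | .lift s => s.size + 1
  | .shift => 1
end

mutual
/-- The number of closures and holes of a pattern. -/
def PatTerm.cost : PatTerm → ℕ
  | .hole => 1
  | .idx _ => 0
  | .lam a => a.cost
  | .app a b => a.cost + b.cost
  | .clos a s => a.cost + s.cost + 1

/-- The number of closures and holes of a pattern. -/
def PatSub.cost : PatSub → ℕ
  | .hole => 1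
  | .slash a => a.cost
  | .lift s => s.cost
  | .shift => 0
end

mutual
/-- The least common refinement of two patterns that have a common instance. -/
def PatTerm.join : PatTerm → PatTerm → PatTerm
  | .hole, q => q
  | .idx n, _ => .idx n
  | .lam a, .lam b => .lam (a.join b)
  | .lam a, _ => .lam a
  | .app a b, .app c d => .app (a.join c) (b.join d)
  | .app a b, _ => .app a b
  | .clos a s, .clos c r => .clos (a.join c) (s.join r)
  | .clos a s, _ => .clos a s

/-- The least common refinement of two patterns that have a common instance. -/
def PatSub.join : PatSub → PatSub → PatSub
  | .hole, q => q
  | .slash a, .slash b => .slash (a.join b)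
  | .slash a, _ => .slash a
  | .lift s, .lift r => .lift (s.join r)
  | .lift s, _ => .lift s
  | .shift, _ => .shift
end

mutual
theorem PatTerm.cost_join (p q : PatTerm) : (p.join q).cost ≤ p.cost + q.cost := by
  cases p with
  | hole => simp [PatTerm.join]
  | idx n => simp [PatTerm.join, PatTerm.cost]
  | lam a =>
    cases q with
    | lam b => simpa [PatTerm.join, PatTerm.cost] using PatTerm.cost_join a b
    | _ => simp [PatTerm.join]
  | app a b =>
    cases q with
    | app c d =>
      have h₁ := PatTerm.cost_join a c
      have h₂ := PatTerm.cost_join b d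
      simp only [PatTerm.join, PatTerm.cost]
      omega
    | _ => simp [PatTerm.join]
  | clos a s =>
    cases q with
    | clos c r =>
      have h₁ := PatTerm.cost_join a c
      have h₂ := PatSub.cost_join s r
      simp only [PatTerm.join, PatTerm.cost]
      omega
    | _ => simp [PatTerm.join]

theorem PatSub.cost_join (p q : PatSub) : (p.join q).cost ≤ p.cost + q.cost := by
  cases p with
  | hole => simp [PatSub.join]
  | shift => simp [PatSub.join, PatSub.cost]
  | slash a =>
    cases q with
    | slash b => simpa [PatSub.join, PatSub.cost] using PatTerm.cost_join a b
    | _ => simp [PatSub.join]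
  | lift s =>
    cases q with
    | lift r => simpa [PatSub.join, PatSub.cost] using PatSub.cost_join s r
    | _ => simp [PatSub.join]
end

mutual
theorem PatTerm.join_le_iff (p q : PatTerm) {t u : LTerm} (hp : p.Le t) (hq : q.Le t) :
    (p.join q).Le u ↔ p.Le u ∧ q.Le u := by
  cases p with
  | hole => simp [PatTerm.join, PatTerm.Le]
  | idx n => cases t <;> cases q <;> cases u <;> simp_all [PatTerm.join, PatTerm.Le]
  | lam a =>
    cases t <;> cases q <;> cases u <;> simp_all only [PatTerm.join, PatTerm.Le] <;>
      first | tauto | exact PatTerm.join_le_iff _ _ hp hq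
  | app a b =>
    cases t <;> cases q <;> cases u <;> simp_all only [PatTerm.join, PatTerm.Le] <;>
      first
      | tauto
      | rw [PatTerm.join_le_iff _ _ hp.1 hq.1, PatTerm.join_le_iff _ _ hp.2 hq.2]; tauto
  | clos a s =>
    cases t <;> cases q <;> cases u <;> simp_all only [PatTerm.join, PatTerm.Le] <;>
      first
      | tauto
      | rw [PatTerm.join_le_iff _ _ hp.1 hq.1, PatSub.join_le_iff _ _ hp.2 hq.2]; tauto

theorem PatSub.join_le_iff (p q : PatSub) {s r : LSub} (hp : p.Le s) (hq : q.Le s) :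
    (p.join q).Le r ↔ p.Le r ∧ q.Le r := by
  cases p with
  | hole => simp [PatSub.join, PatSub.Le]
  | shift => cases s <;> cases q <;> cases r <;> simp_all [PatSub.join, PatSub.Le]
  | slash a =>
    cases s <;> cases q <;> cases r <;> simp_all only [PatSub.join, PatSub.Le] <;>
      first | tauto | exact PatTerm.join_le_iff _ _ hp hq
  | lift p =>
    cases s <;> cases q <;> cases r <;> simp_all only [PatSub.join, PatSub.Le] <;>
      first | tauto | exact PatSub.join_le_iff _ _ hp hq
end

/-- The pattern of `s` induced by a pattern of `⇑(s)`. -/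
def PatSub.unlift : PatSub → PatSub
  | .lift s => s
  | s => s

theorem PatSub.unlift_le_iff {p : PatSub} {s r : LSub} (h : p.Le (.lift s)) :
    p.unlift.Le r ↔ p.Le (.lift r) := by
  cases p <;> simp_all [PatSub.unlift, PatSub.Le]

theorem PatSub.cost_unlift (p : PatSub) : p.unlift.cost = p.cost := by
  cases p <;> simp [PatSub.unlift, PatSub.cost]

/-- A pattern without holes at the positions which every normalisation inspects. -/
def PatTerm.Rigid : PatTerm → Prop
  | .hole => False
  | .idx _ => True
  | .lam a => a.Rigid
  | .app a b => a.Rigid ∧ b.Rigid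
  | .clos a _ => a.Rigid

/-- The hole-free pattern of a pure term. -/
def LTerm.toPat : LTerm → PatTerm
  | .idx n => .idx n
  | .lam a => .lam a.toPat
  | .app a b => .app a.toPat b.toPat
  | .clos _ _ => .hole

theorem LTerm.IsPure.toPat_spec : ∀ {t : LTerm}, t.IsPure →
    t.toPat.Rigid ∧ t.toPat.cost = 0 ∧ t.toPat.Le t ∧ ∀ u, t.toPat.Le u → u = t
  | .idx n, _ => by
    refine ⟨trivial, rfl, rfl, fun u hu => ?_⟩
    cases u <;> simp_all [LTerm.toPat, PatTerm.Le]
  | .lam a, h => by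
    obtain ⟨h₁, h₂, h₃, h₄⟩ := LTerm.IsPure.toPat_spec (t := a) h
    refine ⟨h₁, h₂, h₃, fun u hu => ?_⟩
    cases u with
    | lam b => rw [h₄ b hu]
    | _ => simp [LTerm.toPat, PatTerm.Le] at hu
  | .app a b, h => by
    obtain ⟨h₁, h₂, h₃, h₄⟩ := LTerm.IsPure.toPat_spec (t := a) h.1
    obtain ⟨k₁, k₂, k₃, k₄⟩ := LTerm.IsPure.toPat_spec (t := b) h.2
    refine ⟨⟨h₁, k₁⟩, by simp [LTerm.toPat, PatTerm.cost, h₂, k₂], ⟨h₃, k₃⟩, fun u hu => ?_⟩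
    cases u with
    | app c d => rw [h₄ c hu.1, k₄ d hu.2]
    | _ => simp [LTerm.toPat, PatTerm.Le] at hu
  | .clos _ _, h => h.elim

theorem PatTerm.Rigid.isPure : ∀ {t u : LTerm} {q : PatTerm}, q.Rigid → t.IsPure →
    q.Le t → q.Le u → u.IsPure
  | .idx n, u, q, hq, _, h, h' => by
    cases q <;> cases u <;> simp_all [PatTerm.Le, PatTerm.Rigid, LTerm.IsPure]
  | .lam a, u, q, hq, ht, h, h' => by
    cases q <;> cases u <;> simp_all only [PatTerm.Le, PatTerm.Rigid, LTerm.IsPure]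
    exact PatTerm.Rigid.isPure hq ht h h'
  | .app a b, u, q, hq, ht, h, h' => by
    cases q <;> cases u <;> simp_all only [PatTerm.Le, PatTerm.Rigid, LTerm.IsPure]
    exact ⟨PatTerm.Rigid.isPure hq.1 ht.1 h.1 h'.1, PatTerm.Rigid.isPure hq.2 ht.2 h.2 h'.2⟩
  | .clos _ _, _, _, _, ht, _, _ => ht.elim

/-- `PatStep t t' q' q`: the term `t` reduces to `t'` in one normal-order step, and `q` is the least
pattern of `t` all of whose instances reduce to instances of the pattern `q'` of `t'`. -/
inductive PatStep : LTerm → LTerm → PatTerm → PatTerm → Prop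
  | appS (a b : LTerm) (s : LSub) (x y : PatTerm) (p q : PatSub) :
      PatStep (.clos (.app a b) s) (.app (.clos a s) (.clos b s))
        (.app (.clos x p) (.clos y q)) (.clos (.app x y) (p.join q))
  | lamS (a : LTerm) (s : LSub) (x : PatTerm) (p : PatSub) :
      PatStep (.clos (.lam a) s) (.lam (.clos a (.lift s)))
        (.lam (.clos x p)) (.clos (.lam x) p.unlift)
  | fvar (a : LTerm) (x : PatTerm) :
      PatStep (.clos (.idx 0) (.slash a)) a x (.clos (.idx 0) (.slash x))
  | rvar (n : ℕ) (a : LTerm) (x : PatTerm) :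
      PatStep (.clos (.idx (n + 1)) (.slash a)) (.idx n) x (.clos (.idx (n + 1)) (.slash .hole))
  | fvarLift (s : LSub) (x : PatTerm) :
      PatStep (.clos (.idx 0) (.lift s)) (.idx 0) x (.clos (.idx 0) (.lift .hole))
  | rvarLift (n : ℕ) (s : LSub) (x : PatTerm) (p q : PatSub) :
      PatStep (.clos (.idx (n + 1)) (.lift s)) (.clos (.clos (.idx n) s) .shift)
        (.clos (.clos x p) q) (.clos (.idx (n + 1)) (.lift p))
  | varShift (n : ℕ) (x : PatTerm) :
      PatStep (.clos (.idx n) .shift) (.idx (n + 1)) x (.clos (.idx n) .shift)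
  | lamCong {a a' : LTerm} {x' x : PatTerm} :
      PatStep a a' x' x → PatStep (.lam a) (.lam a') (.lam x') (.lam x)
  | appLeft {a a' : LTerm} {x' x : PatTerm} (b : LTerm) (y : PatTerm) :
      PatStep a a' x' x → PatStep (.app a b) (.app a' b) (.app x' y) (.app x y)
  | appRight {b b' : LTerm} {y' y : PatTerm} (a : LTerm) (x : PatTerm) :
      a.IsPure → PatStep b b' y' y → PatStep (.app a b) (.app a b') (.app x y') (.app x y)
  | closCong {t t' : LTerm} {x' x : PatTerm} (s : LSub) (p : PatSub) :
      (∃ u v, t = LTerm.clos u v) → PatStep t t' x' x →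
        PatStep (.clos t s) (.clos t' s) (.clos x' p) (.clos x p)

theorem NStep.not_isPure {t t' : LTerm} (h : NStep t t') : ¬ t.IsPure := by
  induction h <;> simp_all [LTerm.IsPure]

theorem PatStep.nStep {t t' : LTerm} {q' q : PatTerm} (h : PatStep t t' q' q) : NStep t t' := by
  induction h <;> constructor <;> assumption

theorem NStep.exists_patStep {t t' : LTerm} (h : NStep t t') {q' : PatTerm} (hr : q'.Rigid)
    (hl : q'.Le t') : ∃ q, PatStep t t' q' q := by
  induction h generalizing q' with
  | appS a b s =>
    rcases q' with _ | _ | _ | ⟨x, y⟩ | _ <;> simp_all only [PatTerm.Le, PatTerm.Rigid]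
    cases x <;> cases y <;> simp_all only [PatTerm.Le, PatTerm.Rigid, and_false, false_and]
    exact ⟨_, .appS ..⟩
  | lamS a s =>
    rcases q' with _ | _ | x | _ | _ <;> simp_all only [PatTerm.Le, PatTerm.Rigid]
    cases x <;> simp_all only [PatTerm.Le, PatTerm.Rigid]
    exact ⟨_, .lamS ..⟩
  | fvar a => exact ⟨_, .fvar ..⟩
  | rvar n a => exact ⟨_, .rvar ..⟩
  | fvarLift s => exact ⟨_, .fvarLift ..⟩
  | rvarLift n s =>
    rcases q' with _ | _ | _ | _ | ⟨x, p⟩ <;> simp_all only [PatTerm.Le, PatTerm.Rigid]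
    cases x <;> simp_all only [PatTerm.Le, PatTerm.Rigid, false_and]
    exact ⟨_, .rvarLift ..⟩
  | varShift n => exact ⟨_, .varShift ..⟩
  | lamCong _ ih =>
    cases q' <;> simp_all only [PatTerm.Le, PatTerm.Rigid]
    obtain ⟨q, hq⟩ := ih hr hl
    exact ⟨_, .lamCong hq⟩
  | appLeft b _ ih =>
    cases q' <;> simp_all only [PatTerm.Le, PatTerm.Rigid]
    obtain ⟨q, hq⟩ := ih hr.1 hl.1
    exact ⟨_, .appLeft _ _ hq⟩
  | appRight a ha _ ih =>
    cases q' <;> simp_all only [PatTerm.Le, PatTerm.Rigid]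
    obtain ⟨q, hq⟩ := ih hr.2 hl.2
    exact ⟨_, .appRight _ _ ha hq⟩
  | closCong s hs _ ih =>
    cases q' <;> simp_all only [PatTerm.Le, PatTerm.Rigid]
    obtain ⟨q, hq⟩ := ih hr hl.1
    exact ⟨_, .closCong _ _ hs hq⟩

theorem PatStep.spec {t t' : LTerm} {q' q : PatTerm} (h : PatStep t t' q' q) (hr : q'.Rigid)
    (hl : q'.Le t') : q.Rigid ∧ q.Le t ∧ q.cost ≤ q'.cost + 2 := by
  induction h with
  | appS a b s x y p q =>
    simp only [PatTerm.Rigid, PatTerm.Le, PatTerm.cost] at *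
    have := PatSub.cost_join p q
    exact ⟨hr, ⟨⟨hl.1.1, hl.2.1⟩, (PatSub.join_le_iff p q hl.1.2 hl.2.2).2 ⟨hl.1.2, hl.2.2⟩⟩,
      by omega⟩
  | lamS a s x p =>
    simp only [PatTerm.Rigid, PatTerm.Le, PatTerm.cost] at *
    exact ⟨hr, ⟨hl.1, (PatSub.unlift_le_iff hl.2).2 hl.2⟩, by rw [PatSub.cost_unlift]; omega⟩
  | lamCong _ ih => exact ih hr hl
  | appLeft b y _ ih =>
    have := ih hr.1 hl.1
    exact ⟨⟨this.1, hr.2⟩, ⟨this.2.1, hl.2⟩, by simp only [PatTerm.cost]; omega⟩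
  | appRight a x ha _ ih =>
    have := ih hr.2 hl.2
    exact ⟨⟨hr.1, this.1⟩, ⟨hl.1, this.2.1⟩, by simp only [PatTerm.cost]; omega⟩
  | closCong s p hs _ ih =>
    have := ih hr hl.1
    exact ⟨this.1, ⟨this.2.1, hl.2⟩, by simp only [PatTerm.cost]; omega⟩
  | rvarLift n s x p q =>
    simp only [PatTerm.Rigid, PatTerm.Le, PatTerm.cost, PatSub.cost, PatSub.Le] at *
    exact ⟨trivial, ⟨trivial, hl.1.2⟩, by omega⟩
  | _ => simp_all [PatTerm.Rigid, PatTerm.Le, PatTerm.cost, PatSub.cost, PatSub.Le]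

theorem PatStep.deterministic {t t₁ t₂ : LTerm} {p₁ q₁ p₂ q₂ : PatTerm} (h₁ : PatStep t t₁ p₁ q₁)
    (h₂ : PatStep t t₂ p₂ q₂) : t₁ = t₂ ∧ (p₁ = p₂ → q₁ = q₂) := by
  induction h₁ generalizing t₂ p₂ q₂ with
  | lamCong _ ih =>
    cases h₂ with
    | lamCong h =>
      obtain ⟨rfl, hq⟩ := ih h
      exact ⟨rfl, fun e => by cases e; rw [hq rfl]⟩
  | appLeft b y h₁ ih =>
    cases h₂ with
    | appLeft _ _ h =>
      obtain ⟨rfl, hq⟩ := ih h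
      exact ⟨rfl, fun e => by cases e; rw [hq rfl]⟩
    | appRight _ _ ha h => exact (h₁.nStep.not_isPure ha).elim
  | appRight a x ha h₁ ih =>
    cases h₂ with
    | appLeft _ _ h => exact (h.nStep.not_isPure ha).elim
    | appRight _ _ ha h =>
      obtain ⟨rfl, hq⟩ := ih h
      exact ⟨rfl, fun e => by cases e; rw [hq rfl]⟩
  | closCong s p hs h₁ ih =>
    obtain ⟨u, v, rfl⟩ := hs
    cases h₂ with
    | closCong _ _ _ h =>
      obtain ⟨rfl, hq⟩ := ih h
      exact ⟨rfl, fun e => by cases e; rw [hq rfl]⟩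
  | _ => cases h₂ <;> simp_all

theorem PatStep.exists_clos {u : LTerm} {v : LSub} {t' : LTerm} {q' q : PatTerm}
    (h : PatStep (.clos u v) t' q' q) : ∃ x p, q = .clos x p := by
  cases h <;> exact ⟨_, _, rfl⟩

/-- A reduction step of `t` with pattern `q` is also available in every other instance of `q`. -/
theorem PatStep.transfer {t t' : LTerm} {q' q : PatTerm} (h : PatStep t t' q' q) (hr : q'.Rigid)
    (hl : q'.Le t') {u : LTerm} (hu : q.Le u) : ∃ u', PatStep u u' q' q ∧ q'.Le u' := by
  induction h generalizing u with
  | appS a b s x y p q =>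
    cases u with
    | clos u r =>
      cases u with
      | app c d =>
        simp only [PatTerm.Le] at hl hu
        rw [PatSub.join_le_iff p q hl.1.2 hl.2.2] at hu
        exact ⟨_, .appS .., ⟨hu.1.1, hu.2.1⟩, hu.1.2, hu.2.2⟩
      | _ => simp [PatTerm.Le] at hu
    | _ => simp [PatTerm.Le] at hu
  | lamS a s x p =>
    cases u with
    | clos u r =>
      cases u with
      | lam c =>
        simp only [PatTerm.Le] at hl hu
        rw [PatSub.unlift_le_iff hl.2] at hu
        exact ⟨_, .lamS .., hu⟩
      | _ => simp [PatTerm.Le] at hu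
    | _ => simp [PatTerm.Le] at hu
  | fvar a x =>
    rcases u with _ | _ | _ | ⟨_ | _ | _ | _, _ | _ | _⟩ <;> simp [PatTerm.Le, PatSub.Le] at hu
    obtain ⟨rfl, hu⟩ := hu
    exact ⟨_, .fvar .., hu⟩
  | rvar n a x =>
    rcases u with _ | _ | _ | ⟨_ | _ | _ | _, _ | _ | _⟩ <;> simp [PatTerm.Le, PatSub.Le] at hu
    subst hu
    exact ⟨_, .rvar .., hl⟩
  | fvarLift s x =>
    rcases u with _ | _ | _ | ⟨_ | _ | _ | _, _ | _ | _⟩ <;> simp [PatTerm.Le, PatSub.Le] at hu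
    subst hu
    exact ⟨_, .fvarLift .., hl⟩
  | rvarLift n s x p q =>
    rcases u with _ | _ | _ | ⟨_ | _ | _ | _, _ | _ | _⟩ <;> simp [PatTerm.Le, PatSub.Le] at hu
    obtain ⟨rfl, hu⟩ := hu
    exact ⟨_, .rvarLift .., ⟨hl.1.1, hu⟩, hl.2⟩
  | varShift n x =>
    rcases u with _ | _ | _ | ⟨_ | _ | _ | _, _ | _ | _⟩ <;> simp [PatTerm.Le, PatSub.Le] at hu
    subst hu
    exact ⟨_, .varShift .., hl⟩
  | lamCong _ ih =>
    cases u <;> simp only [PatTerm.Le] at hu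
    obtain ⟨u', h, h'⟩ := ih hr hl hu
    exact ⟨_, .lamCong h, h'⟩
  | appLeft b y _ ih =>
    cases u <;> simp only [PatTerm.Le] at hu
    obtain ⟨u', h, h'⟩ := ih hr.1 hl.1 hu.1
    exact ⟨_, .appLeft _ _ h, h', hu.2⟩
  | appRight a x ha _ ih =>
    cases u <;> simp only [PatTerm.Le] at hu
    obtain ⟨u', h, h'⟩ := ih hr.2 hl.2 hu.2
    exact ⟨_, .appRight _ _ (PatTerm.Rigid.isPure hr.1 ha hl.1 hu.1) h, hu.1, h'⟩
  | closCong s p hs h₁ ih =>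
    cases u with
    | clos c r =>
      obtain ⟨u', h, h'⟩ := ih hr hl.1 hu.1
      obtain ⟨_, _, rfl⟩ := hs
      obtain ⟨_, _, rfl⟩ := h₁.exists_clos
      refine ⟨_, .closCong _ _ ?_ h, h', hu.2⟩
      cases c with
      | clos c r => exact ⟨c, r, rfl⟩
      | _ => exact hu.1.elim
    | _ => simp [PatTerm.Le] at hu

/-- `PatNorm t q k`: the term `t` normalises in `k` normal-order steps, and `q` is the least pattern
of `t` all of whose instances do so. -/
inductive PatNorm : LTerm → PatTerm → ℕ → Prop
  | base {t : LTerm} : t.IsPure → PatNorm t t.toPat 0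
  | step {t t' : LTerm} {q' q : PatTerm} {k : ℕ} :
      PatStep t t' q' q → PatNorm t' q' k → PatNorm t q (k + 1)

theorem PatNorm.spec {t : LTerm} {q : PatTerm} {k : ℕ} (h : PatNorm t q k) :
    q.Rigid ∧ q.Le t ∧ q.cost ≤ 2 * k := by
  induction h with
  | base ht => exact ⟨ht.toPat_spec.1, ht.toPat_spec.2.2.1, ht.toPat_spec.2.1.le⟩
  | step hs _ ih =>
    have := hs.spec ih.1 ih.2.1
    exact ⟨this.1, this.2.1, by omega⟩

theorem PatNorm.normIn {t : LTerm} {q : PatTerm} {k : ℕ} (h : PatNorm t q k) : NormIn t k := by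
  induction h with
  | base ht => exact .base ht
  | step hs _ ih => exact .step hs.nStep ih

theorem NormIn.exists_patNorm {t : LTerm} {k : ℕ} (h : NormIn t k) : ∃ q, PatNorm t q k := by
  induction h with
  | base ht => exact ⟨_, .base ht⟩
  | step hs _ ih =>
    obtain ⟨q', h'⟩ := ih
    obtain ⟨q, hq⟩ := hs.exists_patStep h'.spec.1 h'.spec.2.1
    exact ⟨q, .step hq h'⟩

theorem PatNorm.unique {t : LTerm} {p q : PatTerm} {k : ℕ} (hp : PatNorm t p k)
    (hq : PatNorm t q k) : p = q := by
  induction hp generalizing q with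
  | base ht => cases hq; rfl
  | step hs _ ih =>
    cases hq with
    | step hs' h' =>
      obtain ⟨rfl, h⟩ := hs.deterministic hs'
      exact h (ih h')

theorem PatNorm.transfer {t : LTerm} {q : PatTerm} {k : ℕ} (h : PatNorm t q k) {u : LTerm}
    (hu : q.Le u) : PatNorm u q k := by
  induction h generalizing u with
  | base ht =>
    rw [ht.toPat_spec.2.2.2 u hu]
    exact .base ht
  | step hs h' ih =>
    obtain ⟨u', hs', hu'⟩ := hs.transfer h'.spec.1 h'.spec.2.1 hu
    exact .step hs' (ih hu')

/-- The generating function counting the elements of a type by a natural number statistic. -/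
noncomputable def countSeries {α : Type} (f : α → ℕ) : PowerSeries ℝ :=
  PowerSeries.mk fun n => (Nat.card {a : α // f a = n} : ℝ)

namespace countSeries

open PowerSeries

variable {α β : Type} {f : α → ℕ} {g : β → ℕ}

theorem congr (e : α ≃ β) (h : ∀ a, g (e a) = f a) : countSeries f = countSeries g := by
  ext n
  simp only [countSeries, coeff_mk]
  rw [Nat.card_congr (e.subtypeEquiv (q := fun b => g b = n) fun a => by rw [h a])]

theorem const_unit (n : ℕ) : countSeries (fun _ : Unit => n) = X ^ n := by
  ext m
  simp only [countSeries, coeff_mk, coeff_X_pow]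
  split_ifs with h
  · subst h
    have : Unique {a : Unit // m = m} := ⟨⟨⟨(), rfl⟩⟩, fun _ => rfl⟩
    simp
  · have : IsEmpty {a : Unit // n = m} := ⟨fun a => h a.2.symm⟩
    simp

theorem add_one : countSeries (fun a => f a + 1) = X * countSeries f := by
  ext n
  cases n with
  | zero => simp [countSeries]
  | succ n => simp [countSeries, coeff_succ_X_mul]

theorem sum (hf : ∀ n, Finite {a // f a = n}) (hg : ∀ n, Finite {b // g b = n}) :
    countSeries (Sum.elim f g) = countSeries f + countSeries g := by
  ext n
  have := hf n
  have := hg n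
  simp only [countSeries, coeff_mk, map_add]
  rw [Nat.card_congr (Equiv.subtypeSum (p := fun c => Sum.elim f g c = n))]
  simp [Nat.card_sum]

theorem prod (hf : ∀ n, Finite {a // f a = n}) (hg : ∀ n, Finite {b // g b = n}) :
    countSeries (fun p : α × β => f p.1 + g p.2) = countSeries f * countSeries g := by
  ext n
  simp only [countSeries, coeff_mk, coeff_mul]
  let e : {p : α × β // f p.1 + g p.2 = n} ≃
      Σ x : ↥(Finset.HasAntidiagonal.antidiagonal n), {a // f a = x.1.1} × {b // g b = x.1.2} :=
    { toFun := fun p => ⟨⟨(f p.1.1, g p.1.2), by simpa using p.2⟩, ⟨p.1.1, rfl⟩, ⟨p.1.2, rfl⟩⟩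
      invFun := fun y => ⟨(y.2.1.1, y.2.2.1), by
        rw [y.2.1.2, y.2.2.2]; exact Finset.HasAntidiagonal.mem_antidiagonal.1 y.1.2⟩
      left_inv := fun p => rfl
      right_inv := by
        rintro ⟨⟨⟨i, j⟩, h⟩, ⟨a, ha : f a = i⟩, ⟨b, hb : g b = j⟩⟩
        subst ha hb
        rfl }
  rw [Nat.card_congr e, Nat.card_sigma]
  simp only [Nat.card_prod]
  push_cast
  exact Finset.sum_coe_sort (Finset.HasAntidiagonal.antidiagonal n)
    fun x => (Nat.card {a // f a = x.1} : ℝ) * (Nat.card {b // g b = x.2} : ℝ)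

end countSeries

theorem finite_fiber_of_injective {α β : Type} {f : α → ℕ} {g : β → ℕ}
    (hg : ∀ n, Finite {b // g b = n}) (i : α → β) (hi : Function.Injective i)
    (h : ∀ a, g (i a) = f a) (n : ℕ) : Finite {a // f a = n} :=
  have := hg n
  Finite.of_injective (fun a => (⟨i a.1, (h _).trans a.2⟩ : {b // g b = n}))
    fun _ _ h => Subtype.ext (hi (congrArg Subtype.val h))

mutual
theorem LTerm.size_pos : ∀ t : LTerm, 0 < t.size
  | .idx _ => by simp [LTerm.size]
  | .lam _ | .app _ _ | .clos _ _ => by simp only [LTerm.size]; omega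

theorem LSub.size_pos : ∀ s : LSub, 0 < s.size
  | .slash _ | .lift _ | .shift => by simp only [LSub.size]; omega
end

/-- A λυ-term is an index, an abstraction, an application or a closure. -/
def LTerm.equivSum : LTerm ≃ ℕ ⊕ LTerm ⊕ (LTerm × LTerm) ⊕ (LTerm × LSub) where
  toFun
    | .idx n => .inl n
    | .lam a => .inr (.inl a)
    | .app a b => .inr (.inr (.inl (a, b)))
    | .clos a s => .inr (.inr (.inr (a, s)))
  invFun
    | .inl n => .idx n
    | .inr (.inl a) => .lam a
    | .inr (.inr (.inl (a, b))) => .app a b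
    | .inr (.inr (.inr (a, s))) => .clos a s
  left_inv t := by cases t <;> rfl
  right_inv t := by rcases t with _ | _ | _ | _ <;> rfl

/-- A substitution is of the form `a/`, `⇑(s)` or `↑`. -/
def LSub.equivSum : LSub ≃ LTerm ⊕ LSub ⊕ Unit where
  toFun
    | .slash a => .inl a
    | .lift s => .inr (.inl s)
    | .shift => .inr (.inr ())
  invFun
    | .inl a => .slash a
    | .inr (.inl s) => .lift s
    | .inr (.inr ()) => .shift
  left_inv t := by cases t <;> rfl
  right_inv t := by rcases t with _ | _ | _ <;> rfl

theorem finite_size_le (n : ℕ) :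
    {t : LTerm | t.size ≤ n}.Finite ∧ {s : LSub | s.size ≤ n}.Finite := by
  induction n with
  | zero =>
    constructor
    · convert Set.finite_empty (α := LTerm)
      ext t
      simpa using t.size_pos.ne'
    · convert Set.finite_empty (α := LSub)
      ext s
      simpa using s.size_pos.ne'
  | succ n ih =>
    obtain ⟨hT, hS⟩ := ih
    constructor
    · refine ((((Set.finite_le_nat n).image LTerm.idx).union (hT.image LTerm.lam)).union
        ((hT.image2 LTerm.app hT).union (hT.image2 LTerm.clos hS))).subset fun t ht => ?_
      cases t with
      | idx m => simp_all [LTerm.size]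
      | lam a =>
        simp only [LTerm.size, Set.mem_ofPred_eq] at ht
        exact .inl (.inr ⟨a, by simp only [Set.mem_ofPred_eq]; omega, rfl⟩)
      | app a b =>
        simp only [LTerm.size, Set.mem_ofPred_eq] at ht
        exact .inr (.inl ⟨a, by simp only [Set.mem_ofPred_eq]; omega, b,
          by simp only [Set.mem_ofPred_eq]; omega, rfl⟩)
      | clos a s =>
        simp only [LTerm.size, Set.mem_ofPred_eq] at ht
        exact .inr (.inr ⟨a, by simp only [Set.mem_ofPred_eq]; omega, s,
          by simp only [Set.mem_ofPred_eq]; omega, rfl⟩)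
    · refine (((hT.image LSub.slash).union (hS.image LSub.lift)).union
        (Set.finite_singleton LSub.shift)).subset fun s hs => ?_
      cases s with
      | slash a =>
        simp only [LSub.size, Set.mem_ofPred_eq] at hs
        exact .inl (.inl ⟨a, by simp only [Set.mem_ofPred_eq]; omega, rfl⟩)
      | lift r =>
        simp only [LSub.size, Set.mem_ofPred_eq] at hs
        exact .inl (.inr ⟨r, by simp only [Set.mem_ofPred_eq]; omega, rfl⟩)
      | shift => exact .inr rfl

theorem LTerm.finite_size (n : ℕ) : Finite {t : LTerm // t.size = n} :=
  ((finite_size_le n).1.subset fun _ h => le_of_eq h).to_subtype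

theorem LSub.finite_size (n : ℕ) : Finite {s : LSub // s.size = n} :=
  ((finite_size_le n).2.subset fun _ h => le_of_eq h).to_subtype

open PowerSeries

/-- The Catalan generating function with real coefficients. -/
noncomputable def realCatalan : PowerSeries ℝ := PowerSeries.mk fun n => (catalan n : ℝ)

theorem realCatalan_eq : realCatalan = 1 + X * realCatalan ^ 2 := by
  have h := congrArg (PowerSeries.map (Nat.castRingHom ℝ)) catalanSeries_sq_mul_X_add_one
  have e : PowerSeries.map (Nat.castRingHom ℝ) catalanSeries = realCatalan := by
    ext n; simp [realCatalan]
  simp only [map_add, map_mul, map_pow, e, PowerSeries.map_X, map_one] at h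
  linear_combination -h

theorem countSeries_idx : countSeries (fun n : ℕ => n + 1) * (1 - X) = X := by
  have h : countSeries (fun n : ℕ => n) * (1 - X) = 1 := by
    convert PowerSeries.mk_one_mul_one_sub_eq_one ℝ
    ext n
    simp [countSeries]
  rw [countSeries.add_one, mul_assoc, h, mul_one]

theorem countSeries_term_eq : countSeries LTerm.size =
    countSeries (fun n : ℕ => n + 1) + (X * countSeries LTerm.size +
      (X * (countSeries LTerm.size * countSeries LTerm.size) +
        X * (countSeries LTerm.size * countSeries LSub.size))) := by
  have hi := LTerm.equivSum.symm.injective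
  let sApp : LTerm × LTerm → ℕ := fun p => p.1.size + p.2.size + 1
  let sClos : LTerm × LSub → ℕ := fun p => p.1.size + p.2.size + 1
  let sACl : (LTerm × LTerm) ⊕ (LTerm × LSub) → ℕ := Sum.elim sApp sClos
  let sLam : LTerm → ℕ := fun a => a.size + 1
  let sRest : LTerm ⊕ (LTerm × LTerm) ⊕ (LTerm × LSub) → ℕ := Sum.elim sLam sACl
  have hRest : ∀ c, (LTerm.equivSum.symm (.inr c)).size = sRest c := by
    rintro (_ | _ | _) <;>
      simp [LTerm.equivSum, LTerm.size, sRest, sLam, sACl, sApp, sClos] <;> omega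
  have fRest := finite_fiber_of_injective LTerm.finite_size _ (hi.comp Sum.inr_injective) hRest
  have fLam := finite_fiber_of_injective fRest _ Sum.inl_injective (f := sLam) fun _ => rfl
  have fACl := finite_fiber_of_injective fRest _ Sum.inr_injective (f := sACl) fun _ => rfl
  have fApp := finite_fiber_of_injective fACl _ Sum.inl_injective (f := sApp) fun _ => rfl
  have fClos := finite_fiber_of_injective fACl _ Sum.inr_injective (f := sClos) fun _ => rfl
  have fIdx := finite_fiber_of_injective LTerm.finite_size _ (hi.comp Sum.inl_injective)
    (f := fun n : ℕ => n + 1) fun _ => rfl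
  conv_lhs => rw [countSeries.congr LTerm.equivSum (g := Sum.elim (fun n : ℕ => n + 1) sRest)
    fun t => by
      rcases h : LTerm.equivSum t with n | c
      · rw [LTerm.equivSum.eq_symm_apply.2 h]; rfl
      · rw [LTerm.equivSum.eq_symm_apply.2 h]; exact (hRest c).symm]
  rw [countSeries.sum fIdx fRest, countSeries.sum fLam fACl, countSeries.sum fApp fClos,
    countSeries.add_one (f := LTerm.size),
    countSeries.add_one (f := fun p : LTerm × LTerm => p.1.size + p.2.size),
    countSeries.add_one (f := fun p : LTerm × LSub => p.1.size + p.2.size),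
    countSeries.prod LTerm.finite_size LTerm.finite_size,
    countSeries.prod LTerm.finite_size LSub.finite_size]

theorem countSeries_sub_eq : countSeries LSub.size =
    X * countSeries LTerm.size + (X * countSeries LSub.size + X) := by
  have hi := LSub.equivSum.symm.injective
  let sSlash : LTerm → ℕ := fun a => a.size + 1
  let sLift : LSub → ℕ := fun s => s.size + 1
  let sShift : Unit → ℕ := fun _ => 1
  let sRest : LSub ⊕ Unit → ℕ := Sum.elim sLift sShift
  have hAll : ∀ c, (LSub.equivSum.symm c).size = Sum.elim sSlash sRest c := by
    rintro (_ | _ | _) <;>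
      simp [LSub.equivSum, LSub.size, sRest, sLift, sShift, sSlash] <;> omega
  have fAll := finite_fiber_of_injective LSub.finite_size _ hi hAll
  have fSlash := finite_fiber_of_injective fAll _ Sum.inl_injective (f := sSlash) fun _ => rfl
  have fRest := finite_fiber_of_injective fAll _ Sum.inr_injective (f := sRest) fun _ => rfl
  have fLift := finite_fiber_of_injective fRest _ Sum.inl_injective (f := sLift) fun _ => rfl
  have fShift := finite_fiber_of_injective fRest _ Sum.inr_injective (f := sShift) fun _ => rfl
  conv_lhs => rw [← countSeries.congr LSub.equivSum.symm hAll]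
  rw [countSeries.sum fSlash fRest, countSeries.sum fLift fShift,
    countSeries.add_one (f := LTerm.size), countSeries.add_one (f := LSub.size),
    countSeries.const_unit, pow_one]

theorem one_add_countSeries_term : 1 + countSeries LTerm.size = realCatalan := by
  have hN := countSeries_idx
  have hT := countSeries_term_eq
  have hS := countSeries_sub_eq
  have hC := realCatalan_eq
  set T := countSeries LTerm.size
  set S := countSeries LSub.size
  set N := countSeries (fun n : ℕ => n + 1)
  have hTT : T = X * (1 + T) ^ 2 := by
    linear_combination (1 - X) * hT + hN + X * T * hS
  have : (1 + T - realCatalan) * (1 - X * (1 + T + realCatalan)) = 0 := by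
    linear_combination hTT - hC
  rcases mul_eq_zero.1 this with h | h
  · exact sub_eq_zero.1 h
  · have := congrArg constantCoeff h
    simp at this

/-- The generating function of the instances of a pattern, counted by size. -/
noncomputable def PatTerm.series (q : PatTerm) : PowerSeries ℝ :=
  countSeries fun u : {u : LTerm // q.Le u} => u.1.size

/-- The generating function of the instances of a pattern, counted by size. -/
noncomputable def PatSub.series (q : PatSub) : PowerSeries ℝ :=
  countSeries fun u : {u : LSub // q.Le u} => u.1.size

theorem PatTerm.finite_fiber (q : PatTerm) (n : ℕ) :
    Finite {u : {u : LTerm // q.Le u} // u.1.size = n} :=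
  finite_fiber_of_injective LTerm.finite_size _ Subtype.val_injective (fun _ => rfl) n

theorem PatSub.finite_fiber (q : PatSub) (n : ℕ) :
    Finite {u : {u : LSub // q.Le u} // u.1.size = n} :=
  finite_fiber_of_injective LSub.finite_size _ Subtype.val_injective (fun _ => rfl) n

theorem PatTerm.series_hole : PatTerm.hole.series = countSeries LTerm.size :=
  countSeries.congr (Equiv.subtypeUnivEquiv fun _ => by simp [PatTerm.Le]) fun _ => rfl

theorem PatTerm.series_idx (n : ℕ) : (PatTerm.idx n).series = X ^ (n + 1) := by
  rw [← countSeries.const_unit]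
  refine countSeries.congr
    { toFun := fun _ => ()
      invFun := fun _ => ⟨.idx n, rfl⟩
      left_inv := ?_
      right_inv := fun _ => rfl } ?_
  · rintro ⟨u, hu⟩
    cases u with
    | idx m => exact Subtype.ext (congrArg LTerm.idx hu)
    | _ => exact hu.elim
  · rintro ⟨u, hu⟩
    cases u with
    | idx m => exact congrArg Nat.succ hu
    | _ => exact hu.elim

theorem PatTerm.series_lam (a : PatTerm) : (PatTerm.lam a).series = X * a.series := by
  rw [PatTerm.series, PatTerm.series, ← countSeries.add_one]
  refine (countSeries.congr
    { toFun := fun u => ⟨.lam u.1, u.2⟩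
      invFun := fun
        | ⟨.lam u, h⟩ => ⟨u, h⟩
        | ⟨.idx _, h⟩ | ⟨.app _ _, h⟩ | ⟨.clos _ _, h⟩ => h.elim
      left_inv := fun _ => rfl
      right_inv := ?_ } ?_).symm
  · rintro ⟨u, hu⟩
    cases u <;> first | rfl | exact hu.elim
  · intro u
    simp [LTerm.size, add_comm]

theorem PatTerm.series_app (a b : PatTerm) :
    (PatTerm.app a b).series = X * (a.series * b.series) := by
  rw [PatTerm.series, PatTerm.series, PatTerm.series,
    ← countSeries.prod a.finite_fiber b.finite_fiber, ← countSeries.add_one]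
  refine (countSeries.congr
    { toFun := fun u => ⟨.app u.1.1 u.2.1, u.1.2, u.2.2⟩
      invFun := fun
        | ⟨.app u v, h⟩ => (⟨u, h.1⟩, ⟨v, h.2⟩)
        | ⟨.idx _, h⟩ | ⟨.lam _, h⟩ | ⟨.clos _ _, h⟩ => h.elim
      left_inv := fun _ => rfl
      right_inv := ?_ } ?_).symm
  · rintro ⟨u, hu⟩
    cases u <;> first | rfl | exact hu.elim
  · intro u
    simp only [LTerm.size, Equiv.coe_fn_mk]
    omega

theorem PatTerm.series_clos (a : PatTerm) (s : PatSub) :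
    (PatTerm.clos a s).series = X * (a.series * s.series) := by
  rw [PatTerm.series, PatTerm.series, PatSub.series,
    ← countSeries.prod a.finite_fiber s.finite_fiber, ← countSeries.add_one]
  refine (countSeries.congr
    { toFun := fun u => ⟨.clos u.1.1 u.2.1, u.1.2, u.2.2⟩
      invFun := fun
        | ⟨.clos u v, h⟩ => (⟨u, h.1⟩, ⟨v, h.2⟩)
        | ⟨.idx _, h⟩ | ⟨.lam _, h⟩ | ⟨.app _ _, h⟩ => h.elim
      left_inv := fun _ => rfl
      right_inv := ?_ } ?_).symm
  · rintro ⟨u, hu⟩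
    cases u <;> first | rfl | exact hu.elim
  · intro u
    simp only [LTerm.size, Equiv.coe_fn_mk]
    omega

theorem PatSub.series_hole : PatSub.hole.series = countSeries LSub.size :=
  countSeries.congr (Equiv.subtypeUnivEquiv fun _ => by simp [PatSub.Le]) fun _ => rfl

theorem PatSub.series_slash (a : PatTerm) : (PatSub.slash a).series = X * a.series := by
  rw [PatSub.series, PatTerm.series, ← countSeries.add_one]
  refine (countSeries.congr
    { toFun := fun u => ⟨.slash u.1, u.2⟩
      invFun := fun
        | ⟨.slash u, h⟩ => ⟨u, h⟩
        | ⟨.lift _, h⟩ | ⟨.shift, h⟩ => h.elim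
      left_inv := fun _ => rfl
      right_inv := ?_ } ?_).symm
  · rintro ⟨u, hu⟩
    cases u <;> first | rfl | exact hu.elim
  · intro u
    simp [LSub.size, add_comm]

theorem PatSub.series_lift (s : PatSub) : (PatSub.lift s).series = X * s.series := by
  rw [PatSub.series, PatSub.series, ← countSeries.add_one]
  refine (countSeries.congr
    { toFun := fun u => ⟨.lift u.1, u.2⟩
      invFun := fun
        | ⟨.lift u, h⟩ => ⟨u, h⟩
        | ⟨.slash _, h⟩ | ⟨.shift, h⟩ => h.elim
      left_inv := fun _ => rfl
      right_inv := ?_ } ?_).symm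
  · rintro ⟨u, hu⟩
    cases u <;> first | rfl | exact hu.elim
  · intro u
    simp [LSub.size, add_comm]

theorem PatSub.series_shift : PatSub.shift.series = X := by
  rw [← pow_one (X : PowerSeries ℝ), ← countSeries.const_unit]
  refine countSeries.congr
    { toFun := fun _ => ()
      invFun := fun _ => ⟨.shift, trivial⟩
      left_inv := ?_
      right_inv := fun _ => rfl } ?_
  · rintro ⟨u, hu⟩
    cases u with
    | shift => rfl
    | _ => exact hu.elim
  · rintro ⟨u, hu⟩
    cases u with
    | shift => rfl
    | _ => exact hu.elim

mutual
theorem PatTerm.exists_series_eq : ∀ q : PatTerm, ∃ i j, i + j ≤ q.cost ∧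
    q.series = X ^ q.size * (countSeries LTerm.size ^ i * countSeries LSub.size ^ j)
  | .hole => ⟨1, 0, le_rfl, by simp [PatTerm.series_hole, PatTerm.size]⟩
  | .idx n => ⟨0, 0, le_rfl, by simp [PatTerm.series_idx, PatTerm.size]⟩
  | .lam a => by
    obtain ⟨i, j, h, e⟩ := PatTerm.exists_series_eq a
    exact ⟨i, j, h, by rw [PatTerm.series_lam, e, PatTerm.size]; ring⟩
  | .app a b => by
    obtain ⟨i, j, h, e⟩ := PatTerm.exists_series_eq a
    obtain ⟨i', j', h', e'⟩ := PatTerm.exists_series_eq b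
    exact ⟨i + i', j + j', by simp only [PatTerm.cost]; omega,
      by rw [PatTerm.series_app, e, e', PatTerm.size]; ring⟩
  | .clos a s => by
    obtain ⟨i, j, h, e⟩ := PatTerm.exists_series_eq a
    obtain ⟨i', j', h', e'⟩ := PatSub.exists_series_eq s
    exact ⟨i + i', j + j', by simp only [PatTerm.cost]; omega,
      by rw [PatTerm.series_clos, e, e', PatTerm.size]; ring⟩

theorem PatSub.exists_series_eq : ∀ q : PatSub, ∃ i j, i + j ≤ q.cost ∧
    q.series = X ^ q.size * (countSeries LTerm.size ^ i * countSeries LSub.size ^ j)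
  | .hole => ⟨0, 1, le_rfl, by simp [PatSub.series_hole, PatSub.size]⟩
  | .slash a => by
    obtain ⟨i, j, h, e⟩ := PatTerm.exists_series_eq a
    exact ⟨i, j, h, by rw [PatSub.series_slash, e, PatSub.size]; ring⟩
  | .lift s => by
    obtain ⟨i, j, h, e⟩ := PatSub.exists_series_eq s
    exact ⟨i, j, h, by rw [PatSub.series_lift, e, PatSub.size]; ring⟩
  | .shift => ⟨0, 0, le_rfl, by simp [PatSub.series_shift, PatSub.size]⟩
end

open Filter Topology

theorem catalan_cast_succ (n : ℕ) :
    ((n : ℝ) + 2) * (catalan (n + 1) : ℝ) = (4 * n + 2) * (catalan n : ℝ) := by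
  have h : ((n + 1) * ((n + 2) * catalan (n + 1)) : ℕ) = (n + 1) * ((4 * n + 2) * catalan n) := by
    have h₁ := succ_mul_catalan_eq_centralBinom n
    have h₂ := succ_mul_catalan_eq_centralBinom (n + 1)
    have h₃ := Nat.succ_mul_centralBinom_succ n
    rw [← h₁, ← h₂] at h₃
    linarith
  exact_mod_cast Nat.eq_of_mul_eq_mul_left n.succ_pos h

theorem catalan_cast_pos (n : ℕ) : (0 : ℝ) < catalan n := by
  induction n with
  | zero => simp
  | succ n ih =>
    have h := catalan_cast_succ n
    exact pos_of_mul_pos_right (h ▸ by positivity) (by positivity : (0 : ℝ) ≤ (n : ℝ) + 2)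

theorem catalan_cast_mul_le (m i : ℕ) :
    (catalan m * catalan i : ℝ) ≤ catalan (m + i) := by
  induction i with
  | zero => simp
  | succ i ih =>
    have h₁ := catalan_cast_succ i
    have h₂ := catalan_cast_succ (m + i)
    have hm := catalan_cast_pos m
    have hi := catalan_cast_pos i
    rw [← add_assoc, eq_div_of_mul_eq (by positivity) ((mul_comm _ _).trans h₁),
      eq_div_of_mul_eq (by positivity) ((mul_comm _ _).trans h₂), ← mul_div_assoc,
      div_le_div_iff₀ (by positivity) (by positivity)]
    push_cast
    calc (catalan m * ((4 * i + 2) * catalan i) * (m + i + 2) : ℝ)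
        = catalan m * catalan i * ((4 * i + 2) * (m + i + 2)) := by ring
      _ ≤ catalan (m + i) * ((4 * (m + i) + 2) * (i + 2)) := by
        refine mul_le_mul ih ?_ (by positivity) (by positivity)
        nlinarith [(m.cast_nonneg : (0 : ℝ) ≤ m)]
      _ = _ := by ring

theorem one_le_catalan_cast (n : ℕ) : (1 : ℝ) ≤ catalan n := by
  exact_mod_cast (Nat.cast_pos (α := ℝ)).1 (catalan_cast_pos n)

theorem inv_catalan_cast_le (n : ℕ) :
    (catalan n : ℝ)⁻¹ ≤ (7 / 2) ^ 10 * (2 / 7) ^ n := by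
  suffices h : ((7 : ℝ) / 2) ^ n ≤ (7 / 2) ^ 10 * catalan n by
    have hn := catalan_cast_pos n
    rw [inv_le_iff_one_le_mul₀' hn, show ((2 : ℝ) / 7) = (7 / 2)⁻¹ by norm_num, inv_pow]
    rw [mul_left_comm, ← div_eq_mul_inv, ← mul_div_assoc, one_le_div (by positivity)]
    rw [mul_comm] at h
    linarith
  induction n with
  | zero => norm_num
  | succ n ih =>
    rcases le_or_gt (n + 1) 10 with hn | hn
    · calc ((7 : ℝ) / 2) ^ (n + 1) ≤ (7 / 2) ^ 10 := pow_le_pow_right₀ (by norm_num) hn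
        _ ≤ _ := le_mul_of_one_le_right (by positivity) (one_le_catalan_cast _)
    · have h := catalan_cast_succ n
      have hc := catalan_cast_pos n
      have hn' : (10 : ℝ) ≤ n := by exact_mod_cast (by omega : 10 ≤ n)
      have : (7 / 2 : ℝ) * catalan n ≤ catalan (n + 1) := by
        refine le_of_mul_le_mul_left ?_ (by positivity : (0 : ℝ) < (n : ℝ) + 2)
        rw [h]
        nlinarith
      rw [pow_succ]
      nlinarith [show (0 : ℝ) < (7 / 2) ^ 10 by positivity]

theorem summable_inv_catalan_cast : Summable fun n : ℕ => (catalan n : ℝ)⁻¹ :=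
  .of_nonneg_of_le (fun n => (inv_pos.2 (catalan_cast_pos n)).le) inv_catalan_cast_le
    ((summable_geometric_of_lt_one (by norm_num) (by norm_num)).mul_left _)

theorem tendsto_catalan_div_succ :
    Tendsto (fun n : ℕ => (catalan n : ℝ) / catalan (n + 1)) atTop (𝓝 (1 / 4)) := by
  have h : Tendsto (fun n : ℕ => ((1 : ℝ) * n + 2) / (4 * n + 2)) atTop (𝓝 (1 / 4)) :=
    tendsto_add_mul_div_add_mul_atTop_nhds (𝕜 := ℝ) 2 2 1 (by norm_num : (4 : ℝ) ≠ 0) |>.congr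
      fun n => by ring
  refine h.congr fun n => ?_
  have := catalan_cast_pos (n + 1)
  rw [div_eq_div_iff (by positivity) (by positivity)]
  linear_combination catalan_cast_succ n

/-- The coefficients of a power series, relative to the Catalan numbers, have a limit. -/
def HasCatalanLimit (f : PowerSeries ℝ) : Prop :=
  ∃ l, Tendsto (fun n => coeff n f / catalan n) atTop (𝓝 l)

namespace HasCatalanLimit

variable {f g : PowerSeries ℝ}

theorem sub (hf : HasCatalanLimit f) (hg : HasCatalanLimit g) : HasCatalanLimit (f - g) := by
  obtain ⟨l, hl⟩ := hf
  obtain ⟨m, hm⟩ := hg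
  exact ⟨l - m, (hl.sub hm).congr fun n => by rw [map_sub, sub_div]⟩

theorem one : HasCatalanLimit 1 :=
  ⟨0, tendsto_const_nhds.congr' <| (eventually_ne_atTop 0).mono fun n hn => by
    simp [coeff_one, hn]⟩

theorem realCatalan : HasCatalanLimit realCatalan :=
  ⟨1, tendsto_const_nhds.congr fun n => by
    simp [_root_.realCatalan, (catalan_cast_pos n).ne']⟩

theorem X_mul (hf : HasCatalanLimit f) : HasCatalanLimit (X * f) := by
  obtain ⟨l, hl⟩ := hf
  refine ⟨l * (1 / 4), (tendsto_add_atTop_iff_nat 1).1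
    ((hl.mul tendsto_catalan_div_succ).congr fun n => ?_)⟩
  rw [coeff_succ_X_mul, div_mul_div_cancel₀ (catalan_cast_pos n).ne']

theorem X_pow_mul (hf : HasCatalanLimit f) (d : ℕ) : HasCatalanLimit (X ^ d * f) := by
  induction d with
  | zero => simpa using hf
  | succ d ih => simpa [pow_succ', mul_assoc] using ih.X_mul

theorem of_X_mul (hf : HasCatalanLimit (X * f)) : HasCatalanLimit f := by
  obtain ⟨l, hl⟩ := hf
  refine ⟨l / (1 / 4), ((((tendsto_add_atTop_iff_nat 1).2 hl).div tendsto_catalan_div_succ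
    (by norm_num)).congr fun n => ?_)⟩
  have := catalan_cast_pos (n + 1)
  have := catalan_cast_pos n
  simp only [Pi.div_apply, coeff_succ_X_mul]
  field_simp

theorem exists_bound (hf : HasCatalanLimit f) :
    ∃ M, 0 ≤ M ∧ ∀ n, |coeff n f| ≤ M * catalan n := by
  obtain ⟨l, hl⟩ := hf
  obtain ⟨M, hM⟩ := (Metric.isBounded_range_of_tendsto _ hl).exists_norm_le
  refine ⟨M, (norm_nonneg _).trans (hM _ ⟨0, rfl⟩), fun n => ?_⟩
  have h := hM _ ⟨n, rfl⟩
  have hn := catalan_cast_pos n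
  rwa [Real.norm_eq_abs, abs_div, abs_of_pos hn, div_le_iff₀ hn] at h

end HasCatalanLimit

theorem abs_coeff_X_pow_mul_div_le {f : PowerSeries ℝ} {M : ℝ} (hM : 0 ≤ M)
    (h : ∀ n, |coeff n f| ≤ M * catalan n) (d n : ℕ) :
    |coeff n (X ^ d * f) / (catalan n : ℝ)| ≤ M * (catalan d : ℝ)⁻¹ := by
  have hn := catalan_cast_pos n
  have hd := catalan_cast_pos d
  rw [coeff_X_pow_mul']
  split_ifs with hdn
  · rw [abs_div, abs_of_pos hn, div_le_iff₀ hn]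
    obtain ⟨m, rfl⟩ := Nat.exists_eq_add_of_le hdn
    rw [Nat.add_sub_cancel_left]
    refine (h m).trans ?_
    rw [mul_assoc]
    refine mul_le_mul_of_nonneg_left ?_ hM
    rw [le_inv_mul_iff₀ hd]
    exact catalan_cast_mul_le d m
  · rw [zero_div, abs_zero]
    positivity

theorem tendsto_tsum_coeff_X_pow_mul {ι : Type} {f : ι → PowerSeries ℝ} {d : ι → ℕ} {M : ℝ}
    (hM : 0 ≤ M) (hf : ∀ i, HasCatalanLimit (f i)) (hb : ∀ i n, |coeff n (f i)| ≤ M * catalan n)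
    (hs : Summable fun i => (catalan (d i) : ℝ)⁻¹) :
    ∃ l, Tendsto (fun n => ∑' i, coeff n (X ^ d i * f i) / (catalan n : ℝ)) atTop (𝓝 l) := by
  have h (i) := (hf i).X_pow_mul (d i)
  choose l hl using h
  exact ⟨∑' i, l i, tendsto_tsum_of_dominated_convergence (hs.mul_left M) hl
    (.of_forall fun n i => abs_coeff_X_pow_mul_div_le hM (hb i) (d i) n)⟩

namespace HasCatalanLimit

variable {f : PowerSeries ℝ}

theorem of_mul_one_sub_X (hf : HasCatalanLimit (f * (1 - X))) : HasCatalanLimit f := by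
  obtain ⟨M, hM, hb⟩ := hf.exists_bound
  obtain ⟨l, hl⟩ := tendsto_tsum_coeff_X_pow_mul (ι := ℕ) (d := id) hM (fun _ => hf)
    (fun _ => hb) summable_inv_catalan_cast
  refine ⟨l, hl.congr fun n => ?_⟩
  have hz (i : ℕ) (hi : i ∉ Finset.range (n + 1)) :
      coeff n (X ^ i * (f * (1 - X))) / (catalan n : ℝ) = 0 := by
    rw [coeff_X_pow_mul', if_neg (by simpa using hi), zero_div]
  have h1 : (∑ i ∈ Finset.range (n + 1), X ^ i * (f * (1 - X)) : PowerSeries ℝ) =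
      f - X ^ (n + 1) * f := by
    rw [← Finset.sum_mul]
    linear_combination f * geom_sum_mul_neg (X : PowerSeries ℝ) (n + 1)
  simp only [id]
  rw [tsum_eq_sum hz, ← Finset.sum_div, ← map_sum, h1, map_sub, coeff_X_pow_mul',
    if_neg (by omega), sub_zero]

theorem realCatalan_pow (m : ℕ) : HasCatalanLimit (_root_.realCatalan ^ m) := by
  induction m using Nat.twoStepInduction with
  | zero => simpa using one
  | one => simpa using realCatalan
  | more m h₀ h₁ =>
    refine of_X_mul ?_
    convert h₁.sub h₀ using 1
    linear_combination -_root_.realCatalan ^ m * realCatalan_eq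

theorem sub_pow_mul_realCatalan_pow (j m : ℕ) :
    HasCatalanLimit (countSeries LSub.size ^ j * _root_.realCatalan ^ m) := by
  induction j generalizing m with
  | zero => simpa using realCatalan_pow m
  | succ j ih =>
    refine of_mul_one_sub_X ?_
    convert (ih (m + 1)).X_mul using 1
    linear_combination countSeries LSub.size ^ j * _root_.realCatalan ^ m *
      (countSeries_sub_eq + X * one_add_countSeries_term)

theorem term_pow_mul_sub_pow (i j : ℕ) :
    HasCatalanLimit (countSeries LTerm.size ^ i * countSeries LSub.size ^ j) := by
  suffices h : ∀ m, HasCatalanLimit (countSeries LTerm.size ^ i *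
      (countSeries LSub.size ^ j * _root_.realCatalan ^ m)) by simpa using h 0
  induction i with
  | zero => simpa using sub_pow_mul_realCatalan_pow j
  | succ i ih =>
    intro m
    convert (ih (m + 1)).sub (ih m) using 1
    linear_combination countSeries LTerm.size ^ i * countSeries LSub.size ^ j *
      _root_.realCatalan ^ m * one_add_countSeries_term

end HasCatalanLimit

/-- A pattern of terms is a hole, an index, an abstraction, an application or a closure. -/
def PatTerm.equivSum : PatTerm ≃
    Unit ⊕ ℕ ⊕ PatTerm ⊕ (PatTerm × PatTerm) ⊕ (PatTerm × PatSub) where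
  toFun
    | .hole => .inl ()
    | .idx n => .inr (.inl n)
    | .lam a => .inr (.inr (.inl a))
    | .app a b => .inr (.inr (.inr (.inl (a, b))))
    | .clos a s => .inr (.inr (.inr (.inr (a, s))))
  invFun
    | .inl () => .hole
    | .inr (.inl n) => .idx n
    | .inr (.inr (.inl a)) => .lam a
    | .inr (.inr (.inr (.inl (a, b)))) => .app a b
    | .inr (.inr (.inr (.inr (a, s)))) => .clos a s
  left_inv q := by cases q <;> rfl
  right_inv q := by rcases q with _ | _ | _ | _ | _ <;> rfl

/-- A pattern of substitutions is a hole or of the form `a/`, `⇑(s)` or `↑`. -/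
def PatSub.equivSum : PatSub ≃ Unit ⊕ PatTerm ⊕ PatSub ⊕ Unit where
  toFun
    | .hole => .inl ()
    | .slash a => .inr (.inl a)
    | .lift s => .inr (.inr (.inl s))
    | .shift => .inr (.inr (.inr ()))
  invFun
    | .inl () => .hole
    | .inr (.inl a) => .slash a
    | .inr (.inr (.inl s)) => .lift s
    | .inr (.inr (.inr ())) => .shift
  left_inv q := by cases q <;> rfl
  right_inv q := by rcases q with _ | _ | _ | _ <;> rfl

open scoped ENNReal NNReal

theorem PatTerm.tsum_eq (f : PatTerm → ℝ≥0∞) : ∑' q, f q = f .hole + (∑' n, f (.idx n) +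
    (∑' a, f (.lam a) + (∑' a, ∑' b, f (.app a b) + ∑' a, ∑' s, f (.clos a s)))) := by
  rw [← PatTerm.equivSum.symm.tsum_eq, ENNReal.summable.tsum_sum ENNReal.summable,
    ENNReal.summable.tsum_sum ENNReal.summable, ENNReal.summable.tsum_sum ENNReal.summable,
    ENNReal.summable.tsum_sum ENNReal.summable, tsum_fintype, ENNReal.tsum_prod',
    ENNReal.tsum_prod']
  simp [PatTerm.equivSum]

theorem PatSub.tsum_eq (f : PatSub → ℝ≥0∞) : ∑' q, f q = f .hole + (∑' a, f (.slash a) +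
    (∑' s, f (.lift s) + f .shift)) := by
  rw [← PatSub.equivSum.symm.tsum_eq, ENNReal.summable.tsum_sum ENNReal.summable,
    ENNReal.summable.tsum_sum ENNReal.summable, ENNReal.summable.tsum_sum ENNReal.summable,
    tsum_fintype (β := Unit), tsum_fintype (β := Unit)]
  simp [PatSub.equivSum]

/-- The weight `(2/7)^m * (1/100)^c`, cut off to zero when `m` is at least `N`. -/
noncomputable def cutoffWeight (N m c : ℕ) : ℝ≥0∞ :=
  if m < N then ((2 / 7 : ℝ≥0) : ℝ≥0∞) ^ m * ((1 / 100 : ℝ≥0) : ℝ≥0∞) ^ c else 0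

theorem cutoffWeight_succ_le (N m c : ℕ) :
    cutoffWeight (N + 1) (m + 1) c ≤ (2 / 7 : ℝ≥0) * cutoffWeight N m c := by
  simp only [cutoffWeight, Nat.add_lt_add_iff_right]
  split_ifs
  · rw [pow_succ', mul_assoc]
  · simp

theorem cutoffWeight_add_le (N m m' c c' : ℕ) :
    cutoffWeight N (m + m') (c + c') ≤ cutoffWeight N m c * cutoffWeight N m' c' := by
  simp only [cutoffWeight]
  split_ifs
  · rw [pow_add, pow_add, mul_mul_mul_comm]
  all_goals first | omega | simp

theorem cutoffWeight_cost_succ (N m c : ℕ) :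
    cutoffWeight N m (c + 1) = (1 / 100 : ℝ≥0) * cutoffWeight N m c := by
  simp only [cutoffWeight]
  split_ifs
  · rw [pow_succ', mul_left_comm]
  · simp

theorem cutoffWeight_le (N m c : ℕ) :
    cutoffWeight N m c ≤ ((2 / 7 : ℝ≥0) : ℝ≥0∞) ^ m * ((1 / 100 : ℝ≥0) : ℝ≥0∞) ^ c := by
  rw [cutoffWeight]
  split_ifs
  · rfl
  · simp

theorem tsum_cutoffWeight_le (N : ℕ) :
    ∑' q : PatTerm, cutoffWeight N q.size q.cost ≤ (5 / 4 : ℝ≥0) ∧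
      ∑' s : PatSub, cutoffWeight N s.size s.cost ≤ (1 : ℝ≥0) := by
  induction N with
  | zero => simp [cutoffWeight]
  | succ N ih =>
    obtain ⟨hT, hS⟩ := ih
    have hole : cutoffWeight (N + 1) 0 1 ≤ (1 / 100 : ℝ≥0) := by
      simpa using cutoffWeight_le (N + 1) 0 1
    have one : cutoffWeight (N + 1) 1 0 ≤ (2 / 7 : ℝ≥0) := by
      simpa using cutoffWeight_le (N + 1) 1 0
    have hidx : ∑' n, cutoffWeight (N + 1) (n + 1) 0 ≤ (2 / 5 : ℝ≥0) := by
      calc ∑' n, cutoffWeight (N + 1) (n + 1) 0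
          ≤ ∑' n, ((2 / 7 : ℝ≥0) : ℝ≥0∞) * ((2 / 7 : ℝ≥0) : ℝ≥0∞) ^ n :=
            ENNReal.tsum_le_tsum fun n => by
              simpa [pow_succ'] using cutoffWeight_le (N + 1) (n + 1) 0
        _ = (2 / 5 : ℝ≥0) := by
          rw [ENNReal.tsum_mul_left, ENNReal.tsum_geometric, ← ENNReal.coe_one,
            ← ENNReal.coe_sub, ← ENNReal.coe_inv, ← ENNReal.coe_mul]
          · congr 1
            rw [show (1 - 2 / 7 : ℝ≥0) = 5 / 7 from tsub_eq_of_eq_add (by norm_num)]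
            norm_num
          · rw [show (1 - 2 / 7 : ℝ≥0) = 5 / 7 from tsub_eq_of_eq_add (by norm_num)]
            norm_num
    have unT : ∑' a : PatTerm, cutoffWeight (N + 1) (a.size + 1) a.cost ≤
        (2 / 7 : ℝ≥0) * (5 / 4 : ℝ≥0) :=
      (ENNReal.tsum_le_tsum fun a => cutoffWeight_succ_le _ _ _).trans <| by
        rw [ENNReal.tsum_mul_left]; gcongr
    have unS : ∑' s : PatSub, cutoffWeight (N + 1) (s.size + 1) s.cost ≤
        (2 / 7 : ℝ≥0) * (1 : ℝ≥0) :=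
      (ENNReal.tsum_le_tsum fun a => cutoffWeight_succ_le _ _ _).trans <| by
        rw [ENNReal.tsum_mul_left]; gcongr
    have happ : ∑' (a : PatTerm) (b : PatTerm),
        cutoffWeight (N + 1) (a.size + b.size + 1) (a.cost + b.cost) ≤
        (2 / 7 : ℝ≥0) * ((5 / 4 : ℝ≥0) * (5 / 4 : ℝ≥0)) :=
      (ENNReal.tsum_le_tsum fun a => ENNReal.tsum_le_tsum fun b =>
        (cutoffWeight_succ_le _ _ _).trans (mul_le_mul_right (cutoffWeight_add_le _ _ _ _ _) _)).trans
      <| by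
        simp_rw [ENNReal.tsum_mul_left, ENNReal.tsum_mul_right]; gcongr
    have hclos : ∑' (a : PatTerm) (s : PatSub),
        cutoffWeight (N + 1) (a.size + s.size + 1) (a.cost + s.cost + 1) ≤
        (1 / 100 : ℝ≥0) * ((2 / 7 : ℝ≥0) * ((5 / 4 : ℝ≥0) * (1 : ℝ≥0))) := by
      simp_rw [cutoffWeight_cost_succ, ENNReal.tsum_mul_left]
      refine mul_le_mul_right ((ENNReal.tsum_le_tsum fun a => ENNReal.tsum_le_tsum fun b =>
        (cutoffWeight_succ_le _ _ _).trans (mul_le_mul_right (cutoffWeight_add_le _ _ _ _ _) _)).trans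
        ?_) _
      simp_rw [ENNReal.tsum_mul_left, ENNReal.tsum_mul_right]; gcongr
    constructor
    · rw [PatTerm.tsum_eq]
      refine (add_le_add hole (add_le_add hidx (add_le_add unT (add_le_add happ hclos)))).trans ?_
      norm_cast
      rw [← NNReal.coe_le_coe]
      push_cast
      norm_num
    · rw [PatSub.tsum_eq]
      refine (add_le_add hole (add_le_add unT (add_le_add unS one))).trans ?_
      norm_cast
      rw [← NNReal.coe_le_coe]
      push_cast
      norm_num

theorem PatTerm.summable_weight :
    Summable fun q : PatTerm => (2 / 7 : ℝ) ^ q.size * (1 / 100) ^ q.cost := by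
  have h : Summable fun q : PatTerm => (2 / 7 : ℝ≥0) ^ q.size * (1 / 100) ^ q.cost := by
    rw [← ENNReal.tsum_coe_ne_top_iff_summable]
    refine ne_top_of_le_ne_top (ENNReal.coe_ne_top (r := 5 / 4)) ?_
    rw [ENNReal.tsum_eq_iSup_sum]
    refine iSup_le fun u => ?_
    refine le_trans ?_ (tsum_cutoffWeight_le (u.sup PatTerm.size + 1)).1
    refine le_trans (Finset.sum_le_sum fun q hq => ?_) (ENNReal.sum_le_tsum u)
    rw [cutoffWeight, if_pos (Nat.lt_succ_of_le (Finset.le_sup hq))]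
    push_cast
    rfl
  simpa using NNReal.summable_coe.2 h

theorem PatTerm.summable_inv_catalan (m : ℕ) :
    Summable fun q : {q : PatTerm // q.cost ≤ m} => (catalan q.1.size : ℝ)⁻¹ := by
  refine .of_nonneg_of_le (fun q => (inv_pos.2 (catalan_cast_pos _)).le) (fun q => ?_)
    ((PatTerm.summable_weight.subtype {q | q.cost ≤ m}).mul_left ((7 / 2) ^ 10 * 100 ^ m))
  refine (inv_catalan_cast_le _).trans ?_
  have h : (1 : ℝ) ≤ 100 ^ m * (1 / 100) ^ q.1.cost := by
    rw [one_div, inv_pow, ← div_eq_mul_inv, one_le_div (by positivity)]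
    exact pow_le_pow_right₀ (by norm_num) q.2
  simp only [Function.comp_apply]
  calc (7 / 2 : ℝ) ^ 10 * (2 / 7) ^ q.1.size
      ≤ (7 / 2 : ℝ) ^ 10 * (2 / 7) ^ q.1.size * (100 ^ m * (1 / 100) ^ q.1.cost) :=
        le_mul_of_one_le_right (by positivity) h
    _ = _ := by ring

theorem finite_size_normIn (n k : ℕ) : Finite {t : LTerm // t.size = n ∧ NormIn t k} :=
  ((finite_size_le n).1.subset fun _ h => h.1.le).to_subtype

theorem normCount_eq_tsum (k n : ℕ) :
    (normCount k n : ℝ) = ∑' q : {q : PatTerm // ∃ t, PatNorm t q k}, coeff n q.1.series := by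
  choose p hp using fun (t : {t : LTerm // t.size = n ∧ NormIn t k}) => t.2.2.exists_patNorm
  let e : {t : LTerm // t.size = n ∧ NormIn t k} ≃
      Σ q : {q : PatTerm // ∃ t, PatNorm t q k}, {u : {u : LTerm // q.1.Le u} // u.1.size = n} :=
    { toFun := fun t => ⟨⟨p t, t.1, hp t⟩, ⟨⟨t.1, (hp t).spec.2.1⟩, t.2.1⟩⟩
      invFun := fun x => ⟨x.2.1.1, x.2.2, (x.1.2.choose_spec.transfer x.2.1.2).normIn⟩
      left_inv := fun _ => rfl
      right_inv := by
        rintro ⟨⟨q, t, ht⟩, ⟨⟨u, hq⟩, hu⟩⟩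
        have huq := ht.transfer hq
        have hn : u.size = n ∧ NormIn u k := ⟨hu, huq.normIn⟩
        obtain rfl := (hp ⟨u, hn⟩).unique huq
        rfl }
  have := finite_size_normIn n k
  have := Finite.of_equiv _ e
  have h := e.tsum_eq fun _ => (1 : ℝ)
  rw [tsum_const, nsmul_one, Summable.tsum_sigma (Summable.of_finite)] at h
  rw [normCount, h]
  refine tsum_congr fun q => ?_
  rw [tsum_const, nsmul_one, PatTerm.series, countSeries, coeff_mk]

theorem exists_tendsto_normCount_div_catalan (k : ℕ) :
    ∃ l, Tendsto (fun n => (normCount k n : ℝ) / catalan n) atTop (𝓝 l) := by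
  have hb (i j : ℕ) := (HasCatalanLimit.term_pow_mul_sub_pow i j).exists_bound
  choose M hM hb using hb
  let B := ∑ i ∈ Finset.range (2 * k + 1), ∑ j ∈ Finset.range (2 * k + 1), M i j
  have hB (i j : ℕ) (h : i + j ≤ 2 * k) : M i j ≤ B :=
    (Finset.single_le_sum (f := M i) (fun j _ => hM i j)
      (Finset.mem_range.2 (by omega : j < 2 * k + 1))).trans
    (Finset.single_le_sum (f := fun i => ∑ j ∈ Finset.range (2 * k + 1), M i j)
      (fun i _ => Finset.sum_nonneg fun j _ => hM i j)
      (Finset.mem_range.2 (by omega : i < 2 * k + 1)))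
  have hcost (q : {q : PatTerm // ∃ t, PatNorm t q k}) : q.1.cost ≤ 2 * k :=
    q.2.choose_spec.spec.2.2
  choose i j hij hq using fun q : {q : PatTerm // ∃ t, PatNorm t q k} => q.1.exists_series_eq
  obtain ⟨l, hl⟩ := tendsto_tsum_coeff_X_pow_mul
    (hM 0 0 |>.trans (hB 0 0 (by omega)))
    (fun q => HasCatalanLimit.term_pow_mul_sub_pow (i q) (j q))
    (fun q n => (hb (i q) (j q) n).trans (mul_le_mul_of_nonneg_right
      (hB _ _ ((hij q).trans (hcost q))) (catalan_cast_pos n).le))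
    ((PatTerm.summable_inv_catalan (2 * k)).comp_injective
      (i := fun q => ⟨q.1, hcost q⟩) fun _ _ h => Subtype.ext (congrArg (fun q => q.1) h))
  refine ⟨l, hl.congr fun n => ?_⟩
  rw [normCount_eq_tsum, tsum_div_const]
  exact congrArg (· / _) (tsum_congr fun q => by rw [hq])

theorem termCount_eq_catalan {n : ℕ} (hn : n ≠ 0) : termCount n = catalan n := by
  have h := congrArg (coeff n) one_add_countSeries_term
  simp only [map_add, coeff_one, hn, if_false, zero_add, countSeries, realCatalan, coeff_mk] at h
  exact_mod_cast h

theorem NormIn.app_right {a b : LTerm} {k : ℕ} (ha : a.IsPure) (h : NormIn b k) :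
    NormIn (.app a b) k := by
  induction h with
  | base hb => exact .base ⟨ha, hb⟩
  | step hs _ ih => exact .step (.appRight _ ha hs) ih

theorem exists_normIn (k : ℕ) : ∃ u, NormIn u k := by
  induction k with
  | zero => exact ⟨.idx 0, .base trivial⟩
  | succ k ih =>
    obtain ⟨u, hu⟩ := ih
    exact ⟨.app (.clos (.idx 0) .shift) u, .step (.appLeft _ (.varShift 0)) (hu.app_right trivial)⟩

theorem exists_termCount_le_normCount (k : ℕ) :
    ∃ d, ∀ n, termCount n ≤ normCount (k + 1) (n + d) := by
  obtain ⟨u, hu⟩ := exists_normIn k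
  refine ⟨u.size + 5, fun n => ?_⟩
  have := finite_size_normIn (n + (u.size + 5)) (k + 1)
  refine Nat.card_le_card_of_injective
    (fun a => ⟨.app (.clos (.idx 1) (.slash a.1)) u, ?_,
      .step (.appLeft _ (.rvar 0 _)) (hu.app_right trivial)⟩) fun a b h => Subtype.ext ?_
  · have := a.2
    simp only [LTerm.size, LSub.size]
    omega
  · simpa using h

theorem tendsto_catalan_div_add (d : ℕ) :
    Tendsto (fun n : ℕ => (catalan n : ℝ) / catalan (n + d)) atTop (𝓝 ((1 / 4) ^ d)) := by
  induction d with
  | zero =>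
    refine tendsto_const_nhds.congr fun n => ?_
    simp [(catalan_cast_pos n).ne']
  | succ d ih =>
    rw [pow_succ]
    refine (ih.mul ((tendsto_add_atTop_iff_nat d).2 tendsto_catalan_div_succ)).congr fun n => ?_
    rw [div_mul_div_cancel₀ (catalan_cast_pos _).ne', add_assoc]

/-- For each k ≥ 1, the asymptotic density μ_k = lim_{n→∞} g_n^{(k)}/t_n of
λυ-terms ψ-normalising in exactly k normal-order steps exists and is
strictly positive. -/
theorem density_exists_pos (k : ℕ) (hk : 1 ≤ k) :
    ∃ μ : ℝ, 0 < μ ∧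
      Filter.Tendsto (fun n : ℕ => (normCount k n : ℝ) / (termCount n : ℝ))
        Filter.atTop (nhds μ) := by
  obtain ⟨l, hl⟩ := exists_tendsto_normCount_div_catalan k
  obtain ⟨d, hd⟩ := exists_termCount_le_normCount (k - 1)
  rw [Nat.sub_add_cancel hk] at hd
  refine ⟨l, lt_of_lt_of_le (by positivity : (0 : ℝ) < (1 / 4) ^ d)
    (le_of_tendsto_of_tendsto (tendsto_catalan_div_add d) ((tendsto_add_atTop_iff_nat d).2 hl) ?_),
    hl.congr' ?_⟩
  · filter_upwards [eventually_ne_atTop 0] with n hn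
    rw [← termCount_eq_catalan hn]
    gcongr
    exact hd n
  · filter_upwards [eventually_ne_atTop 0] with n hn
    rw [termCount_eq_catalan hn]
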